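/- For a finitely generated R-module M, Ext^1_R(M, Z) = 0 for every maximal Cohen–Macaulay R-module Z if and only if Ext^1_R(M, ω) = 0 and Ext^1_R(Z, M†) = 0 for every maximal Cohen–Macaulay R-module Z. -/

import Mathlib

open CategoryTheory

noncomputable section

/-- `Ext^n_A(M, N)` as a module. -/
def ext1 (A : Type) [CommRing A] (n : ℕ) (M N : Type) [AddCommGroup M] [Module A M]
    [AddCommGroup N] [Module A N] : ModuleCat A :=
  ((Ext A (ModuleCat A) n).obj (Opposite.op (ModuleCat.of A M))).obj (ModuleCat.of A N)

/-- The depth of a module over a local ring: the least `n` with `Ext^n(k, M) ≠ 0`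
(`⊤` if no such `n`, e.g. for the zero module). -/
def rdepth (A : Type) [CommRing A] [IsLocalRing A] (M : Type) [AddCommGroup M] [Module A M] :
    ℕ∞ :=
  sInf {n : ℕ∞ | ∃ m : ℕ, n = m ∧ ¬ Subsingleton (ext1 A m (IsLocalRing.ResidueField A) M)}

/-- The dimension of a module, `dim M = dim (A / ann M)`. -/
def mdim (A : Type) [CommRing A] (M : Type) [AddCommGroup M] [Module A M] : WithBot ℕ∞ :=
  ringKrullDim (A ⧸ Module.annihilator A M)

/-- `cod M > n`, i.e. `dim A - dim M > n`, i.e. `dim M + n < d`. -/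
def codGT (A : Type) [CommRing A] (d : ℕ) (M : Type) [AddCommGroup M] [Module A M]
    (n : ℕ) : Prop :=
  mdim A M + n < (d : WithBot ℕ∞)

/-- `cod M ≥ n`, i.e. `dim M + n ≤ d`. -/
def codGE (A : Type) [CommRing A] (d : ℕ) (M : Type) [AddCommGroup M] [Module A M]
    (n : ℕ) : Prop :=
  mdim A M + n ≤ (d : WithBot ℕ∞)

/-- Maximal Cohen-Macaulay module over a `d`-dimensional local ring
(the zero module counts as MCM). -/
def IsMCM (A : Type) [CommRing A] [IsLocalRing A] (d : ℕ) (M : Type) [AddCommGroup M]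
    [Module A M] : Prop :=
  Module.Finite A M ∧ (d : ℕ∞) ≤ rdepth A M

/-- Serre's condition `(S_n)`: `depth M_p ≥ min {n, ht p}` for all primes `p`. -/
def SerreS (A : Type) [CommRing A] (n : ℕ) (M : Type) [AddCommGroup M] [Module A M] : Prop :=
  ∀ p : PrimeSpectrum A,
    min (n : WithBot ℕ∞) (ringKrullDim (Localization.AtPrime p.asIdeal))
      ≤ (rdepth (Localization.AtPrime p.asIdeal)
          (LocalizedModule p.asIdeal.primeCompl M) : ℕ∞)

/-- Finite injective dimension: `Ext^m(-, M)` vanishes for all large `m`. -/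
def HasFID (A : Type) [CommRing A] (M : Type) [AddCommGroup M] [Module A M] : Prop :=
  ∃ n : ℕ, ∀ (N : Type) [AddCommGroup N] [Module A N], ∀ m : ℕ, n < m →
    Subsingleton (ext1 A m N M)

/-- `ω` is a canonical module of the `d`-dimensional local ring `A`:
it is maximal Cohen-Macaulay, of finite injective dimension, and of type one. -/
def IsCanonicalModule (A : Type) [CommRing A] [IsLocalRing A] (d : ℕ) (ω : Type)
    [AddCommGroup ω] [Module A ω] : Prop :=
  IsMCM A d ω ∧ HasFID A ω ∧
    Nonempty ((ext1 A d (IsLocalRing.ResidueField A) ω) ≃ₗ[A] IsLocalRing.ResidueField A)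

/-- `μ : M → X` is a CM-preenvelope. -/
def IsCMPreenvelope (A : Type) [CommRing A] [IsLocalRing A] (d : ℕ) {M X : Type}
    [AddCommGroup M] [Module A M] [AddCommGroup X] [Module A X] (μ : M →ₗ[A] X) : Prop :=
  IsMCM A d X ∧ ∀ (Z : Type) [AddCommGroup Z] [Module A Z], IsMCM A d Z →
    ∀ f : M →ₗ[A] Z, ∃ g : X →ₗ[A] Z, g ∘ₗ μ = f

/-- `μ : M → X` is a special CM-preenvelope: a CM-preenvelope with
`Ext^1(coker μ, Z) = 0` for all maximal Cohen-Macaulay `Z`. -/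
def IsSpecialCMPreenvelope (A : Type) [CommRing A] [IsLocalRing A] (d : ℕ) {M X : Type}
    [AddCommGroup M] [Module A M] [AddCommGroup X] [Module A X] (μ : M →ₗ[A] X) : Prop :=
  IsCMPreenvelope A d μ ∧ ∀ (Z : Type) [AddCommGroup Z] [Module A Z], IsMCM A d Z →
    Subsingleton (ext1 A 1 (X ⧸ LinearMap.range μ) Z)

/-- `μ : M → X` is a CM-envelope. -/
def IsCMEnvelope (A : Type) [CommRing A] [IsLocalRing A] (d : ℕ) {M X : Type}
    [AddCommGroup M] [Module A M] [AddCommGroup X] [Module A X] (μ : M →ₗ[A] X) : Prop :=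
  IsCMPreenvelope A d μ ∧ ∀ φ : X →ₗ[A] X, φ ∘ₗ μ = μ → Function.Bijective φ

/-- `π : X → M` is a CM-precover. -/
def IsCMPrecover (A : Type) [CommRing A] [IsLocalRing A] (d : ℕ) {X M : Type}
    [AddCommGroup X] [Module A X] [AddCommGroup M] [Module A M] (π : X →ₗ[A] M) : Prop :=
  IsMCM A d X ∧ ∀ (Z : Type) [AddCommGroup Z] [Module A Z], IsMCM A d Z →
    ∀ f : Z →ₗ[A] M, ∃ g : Z →ₗ[A] X, π ∘ₗ g = f

/-- `π : X → M` is a special CM-precover: a CM-precover with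
`Ext^1(Z, ker π) = 0` for all maximal Cohen-Macaulay `Z`. -/
def IsSpecialCMPrecover (A : Type) [CommRing A] [IsLocalRing A] (d : ℕ) {X M : Type}
    [AddCommGroup X] [Module A X] [AddCommGroup M] [Module A M] (π : X →ₗ[A] M) : Prop :=
  IsCMPrecover A d π ∧ ∀ (Z : Type) [AddCommGroup Z] [Module A Z], IsMCM A d Z →
    Subsingleton (ext1 A 1 Z ↥(LinearMap.ker π))

/-- `π : X → M` is a CM-cover. -/
def IsCMCover (A : Type) [CommRing A] [IsLocalRing A] (d : ℕ) {X M : Type}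
    [AddCommGroup X] [Module A X] [AddCommGroup M] [Module A M] (π : X →ₗ[A] M) : Prop :=
  IsCMPrecover A d π ∧ ∀ φ : X →ₗ[A] X, π ∘ₗ φ = π → Function.Bijective φ

/-- `M` has no nonzero free direct summand. -/
def NoNonzeroFreeSummand (A : Type) [CommRing A] (M : Type) [AddCommGroup M]
    [Module A M] : Prop :=
  ∀ F G : Submodule A M, IsCompl F G → Module.Free A ↥F → F = ⊥

/-- `W` belongs to `add ω`: it is a direct summand of a finite direct sum of copies of `ω`. -/
def InAdd (A : Type) [CommRing A] (ω : Type) [AddCommGroup ω] [Module A ω] (W : Type)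
    [AddCommGroup W] [Module A W] : Prop :=
  ∃ (n : ℕ) (W' : ModuleCat.{0} A), Nonempty ((W × ↥W') ≃ₗ[A] (Fin n → ω))

section delta

variable (A : Type) [CommRing A] (ω : Type) [AddCommGroup ω] [Module A ω]

/-- The natural evaluation map `δ_M : M → M†† = Hom(Hom(M, ω), ω)`. -/
def deltaMap (M : Type) [AddCommGroup M] [Module A M] :
    M →ₗ[A] ((M →ₗ[A] ω) →ₗ[A] ω) :=
  (LinearMap.id : (M →ₗ[A] ω) →ₗ[A] (M →ₗ[A] ω)).flip

/-- The dual `f† = Hom(f, ω)` of a linear map `f`. -/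
def dmap {M N : Type} [AddCommGroup M] [Module A M] [AddCommGroup N] [Module A N]
    (f : M →ₗ[A] N) : (N →ₗ[A] ω) →ₗ[A] (M →ₗ[A] ω) :=
  LinearMap.lcomp A ω f

end delta

/-- The homology `ker g / im f` at the middle spot of `M → N → P`. -/
abbrev homMod (A : Type) [CommRing A] {M N P : Type} [AddCommGroup M] [Module A M]
    [AddCommGroup N] [Module A N] [AddCommGroup P] [Module A P]
    (f : M →ₗ[A] N) (g : N →ₗ[A] P) : Type :=
  ↥(LinearMap.ker g) ⧸ Submodule.comap (LinearMap.ker g).subtype (LinearMap.range f)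

end

section ExtDuality

open CategoryTheory Abelian IsLocalRing

section Comparison

variable {R : Type} [CommRing R] {X Y : ModuleCat.{0} R} (P : ProjectiveResolution X)

namespace CategoryTheory.ProjectiveResolution

lemma mem_ker_linearYonedaObj_iff {m n : ℕ} (f : P.complex.X n ⟶ Y) :
    f ∈ LinearMap.ker ((P.complex.linearYonedaObj R Y).d n m).hom ↔ P.complex.d m n ≫ f = 0 :=
  Iff.rfl

/-- The map sending a cocycle of `Hom(P, Y)` to the class it defines in `Ext`, for a projective
resolution `P` of `X`. -/
noncomputable def cocycleToExt (n : ℕ) :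
    LinearMap.ker ((P.complex.linearYonedaObj R Y).d n (n + 1)).hom →ₗ[R] Ext X Y n where
  toFun f := P.extMk f.1 (n + 1) rfl ((P.mem_ker_linearYonedaObj_iff _).1 f.2)
  map_add' f g := (P.add_extMk _ _ _ _ _ _).symm
  map_smul' r f := by
    have h : (r • f.1 : P.complex.X n ⟶ Y) = (f.1 : P.complex.X n ⟶ Y) ≫ (r • 𝟙 Y) :=
      ((Linear.comp_smul _ _ _ _ r _).trans (congrArg _ (Category.comp_id _))).symm
    rw [RingHom.id_apply, Ext.smul_eq_comp_mk₀]
    refine Eq.trans ?_ (P.extMk_comp_mk₀ _ _ rfl _ _).symm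
    simp only [← h]
    rfl

lemma cocycleToExt_surjective (n : ℕ) :
    Function.Surjective (P.cocycleToExt (Y := Y) n) := by
  intro α
  obtain ⟨f, hf, rfl⟩ := P.extMk_surjective α (n + 1) rfl
  exact ⟨⟨f, (P.mem_ker_linearYonedaObj_iff _).2 hf⟩, rfl⟩

lemma extMk_zero_degree_eq_zero_iff (f : P.complex.X 0 ⟶ Y) (hf : P.complex.d 1 0 ≫ f = 0) :
    P.extMk f 1 rfl hf = 0 ↔ f = 0 := by
  simp only [← P.extEquivCohomologyClass.apply_eq_iff_eq,
    extEquivCohomologyClass_extMk, extEquivCohomologyClass_zero,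
    CochainComplex.HomComplex.CohomologyClass.mk_eq_zero_iff]
  rw [CochainComplex.HomComplex.Cocycle.toSingleMk_mem_coboundaries_iff _ _ _ _ _ 1 (by simp)]
  have hz : Limits.IsZero (P.cochainComplex.X 1) :=
    CochainComplex.isZero_of_isStrictlyLE P.cochainComplex 0 1 (by lia)
  constructor
  · rintro ⟨g, hg⟩
    rw [hz.eq_of_src g 0, Limits.comp_zero] at hg
    exact (cancel_epi (P.cochainComplexXIso (-(0 : ℕ)) 0 rfl).hom).1 (by rw [← hg]; simp)
  · rintro rfl
    exact ⟨0, by simp⟩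

lemma cocycleToExt_eq_zero_iff (n : ℕ)
    (f : LinearMap.ker ((P.complex.linearYonedaObj R Y).d n (n + 1)).hom) :
    P.cocycleToExt n f = 0 ↔
      ∃ g, (P.complex.linearYonedaObj R Y).d ((ComplexShape.up ℕ).prev n) n g = f.1 := by
  obtain ⟨f, hf⟩ := f
  cases n with
  | zero =>
    refine (P.extMk_zero_degree_eq_zero_iff f ((P.mem_ker_linearYonedaObj_iff _).1 hf)).trans ?_
    rw [HomologicalComplex.shape _ _ _ (by simp)]
    exact ⟨fun h => ⟨0, h.symm⟩, fun ⟨_, h⟩ => h.symm⟩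
  | succ n =>
    refine (P.extMk_eq_zero_iff f _ rfl ((P.mem_ker_linearYonedaObj_iff _).1 hf) n rfl).trans ?_
    rw [CochainComplex.prev_nat_succ]
    exact Iff.rfl

/-- `Ext` is the cohomology of `Hom(P, Y)`, linearly, for a projective resolution `P` of `X`. -/
noncomputable def homologyLinearEquivExt (n : ℕ) :
    (P.complex.linearYonedaObj R Y).homology n ≃ₗ[R] Ext X Y n :=
  ((P.complex.linearYonedaObj R Y).isoSc' _ n (n + 1) rfl (by simp)
      |> ShortComplex.homologyMapIso
      |>.trans (ShortComplex.moduleCatHomologyIso _)).toLinearEquiv ≪≫ₗ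
    (Submodule.quotEquivOfEq _ (LinearMap.ker (P.cocycleToExt n)) (by
      refine Submodule.ext fun f => Iff.trans ?_ (P.cocycleToExt_eq_zero_iff n f).symm
      exact exists_congr fun g => Subtype.ext_iff)) ≪≫ₗ
    (P.cocycleToExt n).quotKerEquivOfSurjective (P.cocycleToExt_surjective n)

end CategoryTheory.ProjectiveResolution

/-- Comparison of the two definitions of `Ext` for modules. -/
theorem nonempty_ext1_linearEquiv (n : ℕ) (M N : Type) [AddCommGroup M] [Module R M]
    [AddCommGroup N] [Module R N] :
    Nonempty (ext1 R n M N ≃ₗ[R] Ext (ModuleCat.of R M) (ModuleCat.of R N) n) :=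
  let P := projectiveResolution (ModuleCat.of R M)
  ⟨(P.isoExt n (ModuleCat.of R N)).toLinearEquiv ≪≫ₗ P.homologyLinearEquivExt n⟩

end Comparison

section LongExact

variable {R : Type} [CommRing R] {S : ShortComplex (ModuleCat.{0} R)} (hS : S.ShortExact)
  (X : ModuleCat.{0} R)

include hS

lemma subsingleton_ext_covariant₃ {n : ℕ} (h₂ : Subsingleton (Ext X S.X₂ n))
    (h₁ : Subsingleton (Ext X S.X₁ (n + 1))) : Subsingleton (Ext X S.X₃ n) := by
  refine subsingleton_of_forall_eq 0 fun x => ?_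
  obtain ⟨y, rfl⟩ := Ext.covariant_sequence_exact₃ X hS x rfl (Subsingleton.elim _ _)
  rw [Subsingleton.elim y 0, Ext.zero_comp]

lemma subsingleton_ext_covariant₁ {n : ℕ} (h₃ : Subsingleton (Ext X S.X₃ n))
    (h₂ : Subsingleton (Ext X S.X₂ (n + 1))) : Subsingleton (Ext X S.X₁ (n + 1)) := by
  refine subsingleton_of_forall_eq 0 fun x => ?_
  obtain ⟨y, rfl⟩ := Ext.covariant_sequence_exact₁ X hS x (Subsingleton.elim _ _) rfl
  rw [Subsingleton.elim y 0, Ext.zero_comp]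

lemma subsingleton_ext_covariant₁_zero (h₂ : Subsingleton (Ext X S.X₂ 0)) :
    Subsingleton (Ext X S.X₁ 0) :=
  have := hS.mono_f
  (Ext.postcomp_mk₀_injective_of_mono X S.f).subsingleton

lemma subsingleton_ext_contravariant₂ {n : ℕ} (h₁ : Subsingleton (Ext S.X₁ X n))
    (h₃ : Subsingleton (Ext S.X₃ X n)) : Subsingleton (Ext S.X₂ X n) := by
  refine subsingleton_of_forall_eq 0 fun x => ?_
  obtain ⟨y, rfl⟩ := Ext.contravariant_sequence_exact₂ hS X x (Subsingleton.elim _ _)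
  rw [Subsingleton.elim y 0, Ext.comp_zero]

lemma subsingleton_ext_contravariant₁ {n : ℕ} (h₂ : Subsingleton (Ext S.X₂ X n))
    (h₃ : Subsingleton (Ext S.X₃ X (n + 1))) : Subsingleton (Ext S.X₁ X n) := by
  refine subsingleton_of_forall_eq 0 fun x => ?_
  obtain ⟨y, rfl⟩ := Ext.contravariant_sequence_exact₁ hS X x (add_comm 1 n)
    (Subsingleton.elim _ _)
  rw [Subsingleton.elim y 0, Ext.comp_zero]

lemma subsingleton_ext_contravariant₃ {n : ℕ} (h₁ : Subsingleton (Ext S.X₁ X n))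
    (h₂ : Subsingleton (Ext S.X₂ X (n + 1))) : Subsingleton (Ext S.X₃ X (n + 1)) := by
  refine subsingleton_of_forall_eq 0 fun x => ?_
  obtain ⟨y, rfl⟩ := Ext.contravariant_sequence_exact₃ hS X x (Subsingleton.elim _ _)
    (add_comm 1 n)
  rw [Subsingleton.elim y 0, Ext.comp_zero]

lemma subsingleton_ext_contravariant₃_zero (h₂ : Subsingleton (Ext S.X₂ X 0)) :
    Subsingleton (Ext S.X₃ X 0) :=
  have := hS.epi_g
  (Ext.precomp_mk₀_injective_of_epi X S.g).subsingleton

end LongExact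

section Lifting

variable {R : Type} [CommRing R] {A B C Y : Type} [AddCommGroup A] [Module R A]
  [AddCommGroup B] [Module R B] [AddCommGroup C] [Module R C] [AddCommGroup Y] [Module R Y]
  {f : A →ₗ[R] B} {g : B →ₗ[R] C}

/-- Exact linear maps define a short exact sequence in the category of modules. -/
lemma exists_shortExact (hf : Function.Injective f) (hg : Function.Surjective g)
    (hfg : Function.Exact f g) :
    ∃ w : ModuleCat.ofHom f ≫ ModuleCat.ofHom g = 0,
      (ShortComplex.mk (ModuleCat.ofHom f) (ModuleCat.ofHom g) w).ShortExact :=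
  ⟨by ext x; exact hfg.apply_apply_eq_zero x, ModuleCat.shortComplex_shortExact _ hfg hf hg⟩

lemma subsingleton_ext_zero_iff :
    Subsingleton (Ext (ModuleCat.of R A) (ModuleCat.of R B) 0) ↔ Subsingleton (A →ₗ[R] B) :=
  (Ext.linearEquiv₀ (R := R).trans ModuleCat.homLinearEquiv).toEquiv.subsingleton_congr

lemma exists_extension_of_subsingleton_ext (hf : Function.Injective f)
    (hg : Function.Surjective g) (hfg : Function.Exact f g)
    (h : Subsingleton (Ext (ModuleCat.of R C) (ModuleCat.of R Y) 1)) (u : A →ₗ[R] Y) :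
    ∃ v : B →ₗ[R] Y, v ∘ₗ f = u := by
  obtain ⟨w, hS⟩ := exists_shortExact hf hg hfg
  obtain ⟨x, hx⟩ := Ext.contravariant_sequence_exact₁ hS (ModuleCat.of R Y)
    (Ext.mk₀ (ModuleCat.ofHom u)) rfl (Subsingleton.elim (α := Ext (ModuleCat.of R C) _ 1) _ _)
  obtain ⟨v, rfl⟩ := Ext.homEquiv₀.symm.surjective x
  refine ⟨v.hom, ?_⟩
  rw [Ext.homEquiv₀_symm_apply, Ext.mk₀_comp_mk₀] at hx
  exact congrArg ModuleCat.Hom.hom (Ext.homEquiv₀.symm.injective hx)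

lemma exists_lift_of_subsingleton_ext (hf : Function.Injective f)
    (hg : Function.Surjective g) (hfg : Function.Exact f g)
    (h : Subsingleton (Ext (ModuleCat.of R Y) (ModuleCat.of R A) 1)) (u : Y →ₗ[R] C) :
    ∃ v : Y →ₗ[R] B, g ∘ₗ v = u := by
  obtain ⟨w, hS⟩ := exists_shortExact hf hg hfg
  obtain ⟨x, hx⟩ := Ext.covariant_sequence_exact₃ (ModuleCat.of R Y) hS
    (Ext.mk₀ (ModuleCat.ofHom u)) rfl (Subsingleton.elim (α := Ext _ (ModuleCat.of R A) 1) _ _)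
  obtain ⟨v, rfl⟩ := Ext.homEquiv₀.symm.surjective x
  refine ⟨v.hom, ?_⟩
  rw [Ext.homEquiv₀_symm_apply, Ext.mk₀_comp_mk₀] at hx
  exact congrArg ModuleCat.Hom.hom (Ext.homEquiv₀.symm.injective hx)

lemma subsingleton_ext_one_of_exists_extension [Module.Projective R B]
    (hf : Function.Injective f) (hg : Function.Surjective g) (hfg : Function.Exact f g)
    (h : ∀ u : A →ₗ[R] Y, ∃ v : B →ₗ[R] Y, v ∘ₗ f = u) :
    Subsingleton (Ext (ModuleCat.of R C) (ModuleCat.of R Y) 1) := by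
  obtain ⟨w, hS⟩ := exists_shortExact hf hg hfg
  have : Projective (ModuleCat.of R B) := inferInstance
  refine subsingleton_of_forall_eq 0 fun x => ?_
  obtain ⟨y, rfl⟩ := Ext.contravariant_sequence_exact₃ hS (ModuleCat.of R Y) x
    (Ext.eq_zero_of_projective (P := ModuleCat.of R B) _) (add_zero 1)
  obtain ⟨u, rfl⟩ := Ext.homEquiv₀.symm.surjective y
  obtain ⟨v, hv⟩ := h u.hom
  have hu : u = ModuleCat.ofHom f ≫ ModuleCat.ofHom v := by
    ext x
    exact (LinearMap.congr_fun hv x).symm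
  rw [Ext.homEquiv₀_symm_apply, hu, ← Ext.mk₀_comp_mk₀]
  exact hS.extClass_comp_assoc _

end Lifting

lemma mk₀_smul_id_comp {R : Type} [CommRing R] {X Y : ModuleCat.{0} R} {x : R} {n : ℕ}
    (e : Ext X Y n) : (Ext.mk₀ (x • 𝟙 X)).comp e (zero_add n) = x • e := by
  rw [Ext.mk₀_smul, Ext.smul_comp, Ext.mk₀_id_comp]

section Local

open scoped Pointwise

variable {R : Type} [CommRing R] [IsLocalRing R]

/-- The residue field as an object of the category of modules. -/
noncomputable abbrev residueModule (R : Type) [CommRing R] [IsLocalRing R] : ModuleCat.{0} R :=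
  ModuleCat.of R (ResidueField R)

instance : Module.Finite R (residueModule R) :=
  inferInstanceAs (Module.Finite R (R ⧸ maximalIdeal R))

lemma smul_residueModule_eq_zero {x : R} (hx : x ∈ maximalIdeal R) (v : residueModule R) :
    x • v = 0 := by
  obtain ⟨r, rfl⟩ := Ideal.Quotient.mk_surjective v
  exact (Ideal.Quotient.eq_zero_iff_mem (I := maximalIdeal R)).2 (Ideal.mul_mem_right _ _ hx)

lemma annihilator_residueField : Module.annihilator R (ResidueField R) = maximalIdeal R :=
  Ideal.annihilator_quotient (I := maximalIdeal R)

lemma smul_ext_residueModule_eq_zero {x : R} (hx : x ∈ maximalIdeal R) {N : ModuleCat.{0} R}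
    {n : ℕ} (e : Ext (residueModule R) N n) : x • e = 0 := by
  have h : x • 𝟙 (residueModule R) = 0 := by
    ext v
    exact smul_residueModule_eq_zero hx v
  rw [← Ext.mk₀_id_comp e, ← Ext.smul_comp, ← Ext.mk₀_smul, h, Ext.mk₀_zero, Ext.zero_comp]

lemma subsingleton_of_forall_exists_smul {E : Type} [AddCommGroup E] [Module R E]
    [Module.Finite R E] {x : R} (hx : x ∈ maximalIdeal R) (h : ∀ e : E, ∃ e' : E, x • e' = e) :
    Subsingleton E := by
  rw [← Submodule.subsingleton_iff R, ← subsingleton_iff_bot_eq_top, eq_comm]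
  refine Submodule.eq_bot_of_le_smul_of_le_jacobson_bot (maximalIdeal R) _ Module.Finite.fg_top ?_
    (maximalIdeal_le_jacobson _)
  intro e _
  obtain ⟨e', rfl⟩ := h e
  exact Submodule.smul_mem_smul hx Submodule.mem_top

lemma span_singleton_eq_top_of_forall_sub_mem {E : Type} [AddCommGroup E] [Module R E]
    [Module.Finite R E] (g : E)
    (h : ∀ e : E, ∃ r : R, e - r • g ∈ maximalIdeal R • (⊤ : Submodule R E)) :
    Submodule.span R {g} = ⊤ := by
  rw [eq_top_iff]
  refine Submodule.le_of_le_smul_of_le_jacobson_bot (I := maximalIdeal R) Module.Finite.fg_top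
    (maximalIdeal_le_jacobson _) ?_
  intro e _
  obtain ⟨r, hr⟩ := h e
  rw [← sub_add_cancel e (r • g), add_comm]
  exact Submodule.add_mem_sup
    (Submodule.smul_mem _ _ (Submodule.mem_span_singleton_self g)) hr

instance (N : ModuleCat.{0} R) [Module.Finite R N] (x : R) :
    Module.Finite R (N.smulShortComplex x).X₃ :=
  inferInstanceAs (Module.Finite R (N ⧸ x • (⊤ : Submodule R N)))

lemma exists_injective_residueField (N : ModuleCat.{0} R)
    (h : ¬ Subsingleton (Ext (residueModule R) N 0)) :
    ∃ u : ResidueField R →ₗ[R] N, Function.Injective u := by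
  have h' : ¬ Subsingleton (ResidueField R →ₗ[R] N) := fun h' => h (subsingleton_ext_zero_iff.2 h')
  rw [not_subsingleton_iff_nontrivial] at h'
  obtain ⟨u, hu⟩ := exists_ne (0 : ResidueField R →ₗ[R] N)
  refine ⟨u, ?_⟩
  have : IsSimpleModule R (ResidueField R) :=
    isSimpleModule_iff_isCoatom.2 (maximalIdeal.isMaximal R).out
  exact LinearMap.injective_of_ne_zero hu

lemma subsingleton_ext_residueModule_quotient {N : ModuleCat.{0} R} {x : R}
    (hreg : IsSMulRegular N x) {t : ℕ}
    (h : ∀ i < t + 1, Subsingleton (Ext (residueModule R) N i)) :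
    ∀ i < t, Subsingleton (Ext (residueModule R) (N.smulShortComplex x).X₃ i) :=
  fun i hi => subsingleton_ext_covariant₃ hreg.smulShortComplex_shortExact _
    (h i (by lia)) (h (i + 1) (by lia))

/-- `Ext^{n+1}(k, N)` vanishes if `Ext^n(k, N / xN)` does. -/
lemma subsingleton_ext_residueModule_succ {N : ModuleCat.{0} R} {x : R} (hx : x ∈ maximalIdeal R)
    (hreg : IsSMulRegular N x) {n : ℕ}
    (h : Subsingleton (Ext (residueModule R) (N.smulShortComplex x).X₃ n)) :
    Subsingleton (Ext (residueModule R) N (n + 1)) := by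
  refine subsingleton_of_forall_eq 0 fun e => ?_
  obtain ⟨e', rfl⟩ := Ext.covariant_sequence_exact₁ (residueModule R)
    hreg.smulShortComplex_shortExact (n₁ := n + 1) e
    ((Ext.smul_eq_comp_mk₀ e x).symm.trans (smul_ext_residueModule_eq_zero hx e)) rfl
  rw [Subsingleton.elim e' 0, Ext.zero_comp]
  rfl

variable [IsNoetherianRing R]

lemma exists_isSMulRegular_of_subsingleton_ext (N : ModuleCat.{0} R) [Module.Finite R N]
    (h : Subsingleton (Ext (residueModule R) N 0)) :
    ∃ x ∈ maximalIdeal R, IsSMulRegular N x := by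
  rw [← annihilator_residueField]
  exact IsSMulRegular.subsingleton_linearMap_iff.1 (subsingleton_ext_zero_iff.1 h)

lemma subsingleton_ext_of_smulShortComplex {N Y : ModuleCat.{0} R} [Module.Finite R N]
    [Module.Finite R Y] {x : R} (hx : x ∈ maximalIdeal R) (hreg : IsSMulRegular N x) {n : ℕ}
    (h : Subsingleton (Ext (N.smulShortComplex x).X₃ Y (n + 1))) : Subsingleton (Ext N Y n) := by
  refine subsingleton_of_forall_exists_smul hx fun e => ?_
  obtain ⟨e', he'⟩ := Ext.contravariant_sequence_exact₁ hreg.smulShortComplex_shortExact Y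
    (n₀ := n) e (add_comm 1 n) (Subsingleton.elim _ _)
  exact ⟨e', (mk₀_smul_id_comp e').symm.trans he'⟩

/-- The depth of a nonzero module is at most its dimension. -/
lemma exists_not_subsingleton_ext_residueModule (n : ℕ) (N : ModuleCat.{0} R) [Module.Finite R N]
    [Nontrivial N] (hN : Module.supportDim R N ≤ n) :
    ∃ t ≤ n, ¬ Subsingleton (Ext (residueModule R) N t) := by
  induction n generalizing N with
  | zero =>
    refine ⟨0, le_rfl, fun h => ?_⟩
    obtain ⟨x, hx, hreg⟩ := exists_isSMulRegular_of_subsingleton_ext N h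
    have h1 := Module.supportDim_quotSMulTop_succ_eq_supportDim hreg hx
    have : Nontrivial (QuotSMulTop x N) := nontrivial_quotSMulTop_of_mem_maximalIdeal N hx
    have h2 := (Module.supportDim_ne_bot_iff_nontrivial R (QuotSMulTop x N)).2 this
    rw [← h1] at hN
    revert hN h2
    generalize Module.supportDim R (QuotSMulTop x N) = a
    intro hN h2
    induction a with
    | bot => exact h2 rfl
    | coe a =>
      norm_cast at hN
      simp at hN
  | succ n ih =>
    by_cases h : Subsingleton (Ext (residueModule R) N 0)
    · obtain ⟨x, hx, hreg⟩ := exists_isSMulRegular_of_subsingleton_ext N h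
      have h1 := Module.supportDim_quotSMulTop_succ_eq_supportDim hreg hx
      have : Nontrivial (N.smulShortComplex x).X₃ :=
        nontrivial_quotSMulTop_of_mem_maximalIdeal N hx
      obtain ⟨t, ht, h2⟩ := ih (N.smulShortComplex x).X₃ (by
        change Module.supportDim R (QuotSMulTop x N) ≤ _
        rw [← h1] at hN
        revert hN
        generalize Module.supportDim R (QuotSMulTop x N) = a
        intro hN
        induction a with
        | bot => exact bot_le
        | coe a =>
          norm_cast at hN ⊢
          exact (ENat.addLECancellable_of_ne_top (by simp)).add_le_add_iff_right.1 hN)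
      by_contra! hall
      exact h2 (subsingleton_ext_residueModule_quotient hreg (t := n + 1)
        (fun i hi => hall i (by lia)) t (by lia))
    · exact ⟨0, by lia, h⟩

end Local

section Vanishing

lemma subsingleton_ext_congr_left {R : Type} [CommRing R] {X X' Y : ModuleCat.{0} R} (e : X ≅ X')
    {n : ℕ} (h : Subsingleton (Ext X Y n)) : Subsingleton (Ext X' Y n) := by
  refine subsingleton_of_forall_eq 0 fun x => ?_
  rw [← Ext.mk₀_id_comp x, ← e.inv_hom_id, ← Ext.mk₀_comp_mk₀_assoc,
    Subsingleton.elim ((Ext.mk₀ e.hom).comp x (zero_add n)) 0, Ext.comp_zero]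

lemma subsingleton_ext_of_subsingleton_left {R : Type} [CommRing R] (X Y : ModuleCat.{0} R)
    [Subsingleton X] (n : ℕ) : Subsingleton (Ext X Y n) := by
  refine subsingleton_of_forall_eq 0 fun x => ?_
  have h : 𝟙 X = 0 := by
    ext v
    exact Subsingleton.elim _ _
  rw [← Ext.mk₀_id_comp x, h, Ext.mk₀_zero, Ext.zero_comp]

variable {R : Type} [CommRing R] [IsLocalRing R] [IsNoetherianRing R]

/-- If `Ext^{r+1}(-, Y)` vanishes on finite modules, then `Ext^r(-, Y)` vanishes on finite modules
as soon as it vanishes on the residue field. -/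
lemma subsingleton_ext_of_residueModule {Y : ModuleCat.{0} R} [Module.Finite R Y] {r : ℕ}
    (hY : ∀ (N : ModuleCat.{0} R) [Module.Finite R N], Subsingleton (Ext N Y (r + 1)))
    (hk : Subsingleton (Ext (residueModule R) Y r)) (N : ModuleCat.{0} R) [Module.Finite R N] :
    Subsingleton (Ext N Y r) := by
  refine IsNoetherianRing.induction_on_isQuotientEquivQuotientPrime R (M := N) inferInstance
    (motive := fun N _ _ _ => Subsingleton (Ext (ModuleCat.of R N) Y r)) ?_ ?_ ?_
  · intro N _ _ _ _
    exact subsingleton_ext_of_subsingleton_left (ModuleCat.of R N) Y r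
  · intro N _ _ _ p a
    refine subsingleton_ext_congr_left a.toModuleIso.symm ?_
    by_cases hp : p.asIdeal = maximalIdeal R
    · rw [hp]
      exact hk
    · obtain ⟨x, hx, hxp⟩ : ∃ x ∈ maximalIdeal R, x ∉ p.asIdeal := by
        by_contra! h
        exact hp (le_antisymm (le_maximalIdeal p.2.ne_top) h)
      have hreg : IsSMulRegular (R ⧸ p.asIdeal) x := by
        rw [isSMulRegular_iff_right_eq_zero_of_smul]
        intro v hv
        rw [Algebra.smul_def, mul_eq_zero] at hv
        exact hv.resolve_left fun h => hxp (Ideal.Quotient.eq_zero_iff_mem.1 h)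
      exact subsingleton_ext_of_smulShortComplex (N := ModuleCat.of R (R ⧸ p.asIdeal)) hx hreg
        (hY _)
  · intro N₁ _ _ _ N₂ _ _ _ N₃ _ _ _ f g hf hg hfg h₁ h₃
    obtain ⟨w, hS⟩ := exists_shortExact hf hg hfg
    exact subsingleton_ext_contravariant₂ hS Y h₁ h₃

lemma subsingleton_ext_residueModule_of_forall_le_add {Y : ModuleCat.{0} R} {r : ℕ}
    (hY : ∀ (N : ModuleCat.{0} R) [Module.Finite R N], Subsingleton (Ext N Y (r + 1))) (t : ℕ)
    (N : ModuleCat.{0} R) [Module.Finite R N]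
    (h₁ : ∀ i < t, Subsingleton (Ext (residueModule R) N i))
    (h₂ : ¬ Subsingleton (Ext (residueModule R) N t))
    (h₃ : ∀ i, r ≤ i + t → Subsingleton (Ext N Y i)) :
    Subsingleton (Ext (residueModule R) Y r) := by
  induction t generalizing N with
  | zero =>
    obtain ⟨u, hu⟩ := exists_injective_residueField N h₂
    obtain ⟨w, hS⟩ := exists_shortExact hu (Submodule.mkQ_surjective (LinearMap.range u))
      (LinearMap.exact_map_mkQ_range u)
    exact subsingleton_ext_contravariant₁ hS Y (h₃ r le_rfl)
      (hY (ModuleCat.of R (N ⧸ LinearMap.range u)))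
  | succ t ih =>
    obtain ⟨x, hx, hreg⟩ := exists_isSMulRegular_of_subsingleton_ext N (h₁ 0 (by lia))
    refine ih (N.smulShortComplex x).X₃ (subsingleton_ext_residueModule_quotient hreg h₁)
      (fun h => h₂ (subsingleton_ext_residueModule_succ hx hreg h)) fun i hi => ?_
    cases i with
    | zero =>
      exact subsingleton_ext_contravariant₃_zero hreg.smulShortComplex_shortExact Y
        (h₃ 0 (by lia))
    | succ i =>
      exact subsingleton_ext_contravariant₃ hreg.smulShortComplex_shortExact Y
        (h₃ i (by lia)) (h₃ (i + 1) (by lia))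

lemma exists_forall_lt_and_not_subsingleton_ext {d : ℕ} (hd : ringKrullDim R = d)
    (N : ModuleCat.{0} R) [Module.Finite R N] [Nontrivial N] :
    ∃ t ≤ d, (∀ i < t, Subsingleton (Ext (residueModule R) N i)) ∧
      ¬ Subsingleton (Ext (residueModule R) N t) := by
  classical
  have h := exists_not_subsingleton_ext_residueModule d N
    ((Module.supportDim_le_ringKrullDim R N).trans hd.le)
  have h' : ∃ t, ¬ Subsingleton (Ext (residueModule R) N t) := ⟨_, h.choose_spec.2⟩
  refine ⟨Nat.find h', (Nat.find_min' h' h.choose_spec.2).trans h.choose_spec.1, fun i hi => ?_,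
    Nat.find_spec h'⟩
  exact not_not.1 (Nat.find_min h' hi)

/-- The injective dimension of a finite module, if finite, is at most the dimension of the
ring. -/
lemma subsingleton_ext_of_ringKrullDim_lt {d : ℕ} (hd : ringKrullDim R = d) {ω : ModuleCat.{0} R}
    [Module.Finite R ω] (n : ℕ) (hω : ∀ (N : ModuleCat.{0} R) [Module.Finite R N] (i : ℕ),
      d + n < i → Subsingleton (Ext N ω i))
    (N : ModuleCat.{0} R) [Module.Finite R N] {i : ℕ} (hi : d < i) :
    Subsingleton (Ext N ω i) := by
  induction n with
  | zero => exact hω N i hi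
  | succ n ih =>
    have key (N : ModuleCat.{0} R) [Module.Finite R N] : Subsingleton (Ext N ω (d + n + 1)) := by
      have hY (N : ModuleCat.{0} R) [Module.Finite R N] :
          Subsingleton (Ext N ω (d + n + 1 + 1)) := hω N _ (by lia)
      obtain ⟨t, ht, h₁, h₂⟩ :=
        exists_forall_lt_and_not_subsingleton_ext hd (ModuleCat.of R R)
      refine subsingleton_ext_of_residueModule hY
        (subsingleton_ext_residueModule_of_forall_le_add hY t _ h₁ h₂ fun i hi => ?_) N
      obtain ⟨i, rfl⟩ : ∃ j, i = j + 1 := ⟨i - 1, by lia⟩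
      exact subsingleton_of_forall_eq 0 fun x => Ext.eq_zero_of_projective x
    refine ih fun N _ i hi => ?_
    rcases (show d + n + 1 ≤ i by lia).eq_or_lt with rfl | h
    · exact key N
    · exact hω N i (by lia)

lemma subsingleton_of_forall_subsingleton_ext {d : ℕ} (hd : ringKrullDim R = d)
    {ω : ModuleCat.{0} R} (hω : ∀ (N : ModuleCat.{0} R) [Module.Finite R N] (i : ℕ),
      d < i → Subsingleton (Ext N ω i))
    (hk : ¬ Subsingleton (Ext (residueModule R) ω d)) (N : ModuleCat.{0} R) [Module.Finite R N]
    (hN : ∀ i, Subsingleton (Ext N ω i)) : Subsingleton N := by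
  by_contra h
  rw [not_subsingleton_iff_nontrivial] at h
  obtain ⟨t, ht, h₁, h₂⟩ := exists_forall_lt_and_not_subsingleton_ext hd N
  exact hk (subsingleton_ext_residueModule_of_forall_le_add (fun N _ => hω N _ (by lia)) t N h₁ h₂
    fun i _ => hN i)

lemma subsingleton_ext_of_lt_add {d : ℕ} {ω : ModuleCat.{0} R} [Module.Finite R ω]
    (hω : ∀ (N : ModuleCat.{0} R) [Module.Finite R N] (i : ℕ), d < i → Subsingleton (Ext N ω i))
    (t : ℕ) (N : ModuleCat.{0} R) [Module.Finite R N]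
    (h : ∀ i < t, Subsingleton (Ext (residueModule R) N i)) {i : ℕ} (hi : d < i + t) :
    Subsingleton (Ext N ω i) := by
  induction t generalizing N i with
  | zero => exact hω N i hi
  | succ t ih =>
    obtain ⟨x, hx, hreg⟩ := exists_isSMulRegular_of_subsingleton_ext N (h 0 (by lia))
    exact subsingleton_ext_of_smulShortComplex hx hreg
      (ih _ (subsingleton_ext_residueModule_quotient hreg h) (by lia))

end Vanishing

section Cyclic

variable {R : Type} [CommRing R] [IsLocalRing R]

lemma exists_ne_zero_forall_exists_eq_smul {E : Type} [AddCommGroup E] [Module R E]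
    (φ : E ≃ₗ[R] ResidueField R) : ∃ g : E, g ≠ 0 ∧ ∀ e : E, ∃ r : R, e = r • g := by
  refine ⟨φ.symm 1, by simp, fun e => ?_⟩
  obtain ⟨r, hr⟩ := IsLocalRing.residue_surjective (φ e)
  refine ⟨r, ?_⟩
  rw [← map_smul, LinearEquiv.eq_symm_apply, ← hr, Algebra.smul_def, mul_one]
  rfl

lemma exists_residueField_map {N : Type} [AddCommGroup N] [Module R N] (v : N)
    (hv : ∀ x ∈ maximalIdeal R, x • v = 0) : ∃ f : ResidueField R →ₗ[R] N, f 1 = v := by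
  refine ⟨Submodule.liftQ (maximalIdeal R) (LinearMap.toSpanSingleton R N v) fun x hx => hv x hx,
    ?_⟩
  exact (Submodule.liftQ_apply _ _ (1 : R)).trans (one_smul R v)

variable [IsNoetherianRing R]

lemma mem_smul_top_of_comp_eq_zero {d : ℕ} {ω : ModuleCat.{0} R}
    (hω : ∀ (N : ModuleCat.{0} R) [Module.Finite R N], Subsingleton (Ext N ω (d + 1)))
    {N : ModuleCat.{0} R} [Module.Finite R N] {u : ResidueField R →ₗ[R] N}
    (hu : Function.Injective u)
    (hu' : ∀ v : ResidueField R →ₗ[R] N, ∃ r : R, v = r • u) (e : Ext N ω d)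
    (he : (Ext.mk₀ (X := residueModule R) (ModuleCat.ofHom u)).comp e (zero_add d) = 0) :
    e ∈ maximalIdeal R • (⊤ : Submodule R (Ext N ω d)) := by
  obtain ⟨n, a, ha⟩ := Submodule.fg_iff_exists_fin_generating_family.1
    (IsNoetherian.noetherian (maximalIdeal R))
  have hmem (i : Fin n) : a i ∈ maximalIdeal R :=
    ha ▸ Submodule.subset_span (Set.mem_range_self i)
  let φ : N →ₗ[R] (Fin n → N) := LinearMap.pi fun i => a i • LinearMap.id
  have hφ : Function.Exact u φ.rangeRestrict := by
    intro v
    rw [← LinearMap.mem_ker, LinearMap.ker_rangeRestrict, LinearMap.mem_ker]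
    constructor
    · intro hv
      have hann : maximalIdeal R ≤ LinearMap.ker (LinearMap.toSpanSingleton R N v) := by
        rw [← ha, Submodule.span_le]
        rintro _ ⟨i, rfl⟩
        exact congrFun hv i
      obtain ⟨f, rfl⟩ := exists_residueField_map v fun x hx => hann hx
      obtain ⟨r, rfl⟩ := hu' f
      exact ⟨r • 1, map_smul u r 1⟩
    · rintro ⟨c, rfl⟩
      ext i
      change a i • u c = 0
      rw [← map_smul, smul_residueModule_eq_zero (hmem i) c, map_zero]
  obtain ⟨w, hS⟩ := exists_shortExact hu φ.surjective_rangeRestrict hφ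
  obtain ⟨w', hS'⟩ := exists_shortExact φ.range.injective_subtype φ.range.mkQ_surjective
    (LinearMap.exact_subtype_mkQ φ.range)
  obtain ⟨e', he'⟩ := Ext.contravariant_sequence_exact₂ hS ω e he
  obtain ⟨e'', he''⟩ := Ext.contravariant_sequence_exact₁ hS' ω e' (add_comm 1 d)
    (Subsingleton.elim (h := hω (ModuleCat.of R ((Fin n → N) ⧸ LinearMap.range φ))) _ _)
  have hsum : ModuleCat.ofHom φ.rangeRestrict ≫ ModuleCat.ofHom φ.range.subtype =
      ∑ i, a i • ModuleCat.ofHom (LinearMap.single R (fun _ : Fin n => N) i) := by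
    ext v j
    change a j • v = _
    simp [ModuleCat.hom_sum, Pi.single_apply]
  have key : e = ∑ i, a i • (Ext.mk₀ (ModuleCat.ofHom
      (LinearMap.single R (fun _ : Fin n => (N : Type)) i))).comp e'' (zero_add d) := by
    rw [← he', ← he'']
    refine (Ext.mk₀_comp_mk₀_assoc _ _ _).trans ?_
    refine (congrArg (fun z => (Ext.mk₀ z).comp e'' (zero_add d)) hsum).trans ?_
    rw [Ext.mk₀_sum, Ext.sum_comp]
    simp only [Ext.mk₀_smul, Ext.smul_comp]
  rw [key]
  exact Submodule.sum_mem _ fun i _ => Submodule.smul_mem_smul (hmem i) Submodule.mem_top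

/-- If `N` has depth `t` and type one, then `Ext^{d-t}(N, ω)` is cyclic. -/
lemma exists_span_singleton_ext_eq_top {d : ℕ} {ω : ModuleCat.{0} R} [Module.Finite R ω]
    (hω : ∀ (N : ModuleCat.{0} R) [Module.Finite R N] (i : ℕ), d < i → Subsingleton (Ext N ω i))
    (φ : Ext (residueModule R) ω d ≃ₗ[R] ResidueField R) (t s : ℕ) (hst : s + t = d)
    (N : ModuleCat.{0} R) [Module.Finite R N]
    (h : ∀ i < t, Subsingleton (Ext (residueModule R) N i))
    (ψ : Ext (residueModule R) N t ≃ₗ[R] ResidueField R) :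
    ∃ g : Ext N ω s, Submodule.span R {g} = ⊤ := by
  induction t generalizing N s with
  | zero =>
    obtain rfl : s = d := hst
    obtain ⟨u, hu0, hu'⟩ := exists_ne_zero_forall_exists_eq_smul
      (((Ext.linearEquiv₀ (R := R)).trans ModuleCat.homLinearEquiv).symm.trans ψ)
    have : IsSimpleModule R (ResidueField R) :=
      isSimpleModule_iff_isCoatom.2 (maximalIdeal.isMaximal R).out
    have hu : Function.Injective u := LinearMap.injective_of_ne_zero hu0
    obtain ⟨w, hS⟩ := exists_shortExact hu (Submodule.mkQ_surjective (LinearMap.range u))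
      (LinearMap.exact_map_mkQ_range u)
    obtain ⟨ε, -, hε⟩ := exists_ne_zero_forall_exists_eq_smul φ
    obtain ⟨g, hg⟩ := Ext.contravariant_sequence_exact₁ hS ω ε (add_comm 1 s)
      (Subsingleton.elim (h := hω (ModuleCat.of R (N ⧸ LinearMap.range u)) _ (by lia)) _ _)
    refine ⟨g, span_singleton_eq_top_of_forall_sub_mem g fun e => ?_⟩
    obtain ⟨r, hr⟩ := hε
      ((Ext.mk₀ (X := residueModule R) (ModuleCat.ofHom u)).comp e (zero_add s))
    refine ⟨r, mem_smul_top_of_comp_eq_zero (fun N _ => hω N _ (by lia)) hu hu' _ ?_⟩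
    rw [sub_eq_add_neg, Ext.comp_add, Ext.comp_neg, Ext.comp_smul, hr, ← hg, add_neg_cancel]
  | succ t ih =>
    obtain ⟨x, hx, hreg⟩ := exists_isSMulRegular_of_subsingleton_ext N (h 0 (by lia))
    have hS := hreg.smulShortComplex_shortExact
    let δ := hS.extClass.postcompOfLinear R (residueModule R) (a := t) rfl
    have hδ : Function.Bijective δ := by
      constructor
      · rw [injective_iff_map_eq_zero]
        intro e he
        obtain ⟨e', rfl⟩ := Ext.covariant_sequence_exact₃ _ hS e rfl he
        have : e' = 0 := Subsingleton.elim (h := h t (by lia)) _ _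
        rw [this, Ext.zero_comp]
      · intro e
        exact Ext.covariant_sequence_exact₁ (residueModule R) hS (n₁ := t + 1) e
          ((Ext.smul_eq_comp_mk₀ e x).symm.trans (smul_ext_residueModule_eq_zero hx e)) rfl
    obtain ⟨g', hg'⟩ := ih (s + 1) (by lia) (N.smulShortComplex x).X₃
      (subsingleton_ext_residueModule_quotient hreg h)
      ((LinearEquiv.ofBijective δ hδ).trans ψ)
    obtain ⟨(g : Ext N ω s), rfl⟩ := Ext.contravariant_sequence_exact₃ hS ω g'
      (Subsingleton.elim (h := subsingleton_ext_of_lt_add hω (t + 1) N h (by lia)) _ _)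
      (add_comm 1 s)
    refine ⟨g, span_singleton_eq_top_of_forall_sub_mem g fun e => ?_⟩
    obtain ⟨r, hr⟩ := Submodule.mem_span_singleton.1
      (hg' ▸ Submodule.mem_top : hS.extClass.comp e (add_comm 1 s) ∈ Submodule.span R _)
    refine ⟨r, ?_⟩
    let D : Ext N ω s →ₗ[R] Ext (N.smulShortComplex x).X₃ ω (s + 1) :=
      Ext.precompOfLinear hS.extClass R ω (add_comm 1 s)
    have hD : D (e - r • g) = 0 := by
      rw [map_sub, map_smul, sub_eq_zero]
      exact hr.symm
    obtain ⟨e', he'⟩ := Ext.contravariant_sequence_exact₁ hS ω (e - r • g) (add_comm 1 s) hD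
    rw [← he']
    exact (mk₀_smul_id_comp (x := x) e').symm ▸ Submodule.smul_mem_smul hx Submodule.mem_top

end Cyclic

section Duality

/-- The module `Z` has depth at least `d`: `Ext^i(k, Z) = 0` for all `i < d`. -/
def DepthAtLeast (R : Type) [CommRing R] [IsLocalRing R] (d : ℕ) (Z : Type) [AddCommGroup Z]
    [Module R Z] : Prop :=
  ∀ i < d, Subsingleton (Ext (residueModule R) (ModuleCat.of R Z) i)

/-- `ω` is a maximal Cohen-Macaulay module of type one over the `d`-dimensional Cohen-Macaulay
local ring `R`, of injective dimension at most `d`. -/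
structure IsDualizing (R : Type) [CommRing R] [IsLocalRing R] (d : ℕ) (ω : Type) [AddCommGroup ω]
    [Module R ω] : Prop where
  ringKrullDim_eq : ringKrullDim R = d
  depth_ring : DepthAtLeast R d R
  depth : DepthAtLeast R d ω
  subsingleton_ext (N : ModuleCat.{0} R) [Module.Finite R N] (i : ℕ) :
    d < i → Subsingleton (Ext N (ModuleCat.of R ω) i)
  type_one : Nonempty (Ext (residueModule R) (ModuleCat.of R ω) d ≃ₗ[R] ResidueField R)

section Depth

variable {R : Type} [CommRing R]

lemma subsingleton_ext_congr_right {X Y Y' : ModuleCat.{0} R} (e : Y ≅ Y') {n : ℕ}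
    (h : Subsingleton (Ext X Y n)) : Subsingleton (Ext X Y' n) := by
  refine subsingleton_of_forall_eq 0 fun x => ?_
  rw [← Ext.comp_mk₀_id x, ← e.inv_hom_id, ← Ext.mk₀_comp_mk₀,
    ← Ext.comp_assoc x (Ext.mk₀ e.inv) (Ext.mk₀ e.hom) (add_zero n) (add_zero 0) (by lia),
    Subsingleton.elim (x.comp (Ext.mk₀ e.inv) (add_zero n)) 0, Ext.zero_comp]

lemma subsingleton_ext_pi (X : ModuleCat.{0} R) {A : Type} [AddCommGroup A] [Module R A] (n : ℕ)
    {i : ℕ} (h : Subsingleton (Ext X (ModuleCat.of R A) i)) :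
    Subsingleton (Ext X (ModuleCat.of R (Fin n → A)) i) := by
  have hid : 𝟙 (ModuleCat.of R (Fin n → A)) = ∑ j : Fin n,
      ModuleCat.ofHom (LinearMap.proj (R := R) (φ := fun _ : Fin n => A) j) ≫
        ModuleCat.ofHom (LinearMap.single R (fun _ : Fin n => A) j) := by
    ext v l
    simp [ModuleCat.hom_sum, Pi.single_apply]
  refine subsingleton_of_forall_eq 0 fun x => ?_
  rw [← Ext.comp_mk₀_id x, hid, Ext.mk₀_sum, Ext.comp_sum]
  refine Finset.sum_eq_zero fun j _ => ?_
  rw [← Ext.mk₀_comp_mk₀, ← Ext.comp_assoc x _ _ (add_zero i) (add_zero 0) (by lia),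
    Subsingleton.elim (x.comp _ (add_zero i)) 0, Ext.zero_comp]

variable [IsLocalRing R] {d : ℕ} {A B C : Type} [AddCommGroup A] [Module R A]
  [AddCommGroup B] [Module R B] [AddCommGroup C] [Module R C]

lemma DepthAtLeast.pi (hA : DepthAtLeast R d A) (n : ℕ) : DepthAtLeast R d (Fin n → A) :=
  fun i hi => subsingleton_ext_pi _ n (hA i hi)

lemma DepthAtLeast.congr (e : A ≃ₗ[R] B) (hA : DepthAtLeast R d A) : DepthAtLeast R d B :=
  fun i hi => subsingleton_ext_congr_right e.toModuleIso (hA i hi)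

lemma DepthAtLeast.ker_succ {g : B →ₗ[R] C} (hg : Function.Surjective g)
    (hB : DepthAtLeast R (d + 1) B) (hC : DepthAtLeast R d C) :
    DepthAtLeast R (d + 1) (LinearMap.ker g) := by
  obtain ⟨w, hS⟩ := exists_shortExact (LinearMap.ker g).injective_subtype hg
    (LinearMap.exact_subtype_ker_map g)
  intro i hi
  cases i with
  | zero => exact subsingleton_ext_covariant₁_zero hS _ (hB 0 hi)
  | succ i => exact subsingleton_ext_covariant₁ hS _ (hC i (by lia)) (hB (i + 1) hi)

lemma DepthAtLeast.mono {e : ℕ} (he : e ≤ d) (hA : DepthAtLeast R d A) : DepthAtLeast R e A :=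
  fun i hi => hA i (by lia)

lemma DepthAtLeast.ker {g : B →ₗ[R] C} (hg : Function.Surjective g)
    (hB : DepthAtLeast R d B) (hC : DepthAtLeast R d C) :
    DepthAtLeast R d (LinearMap.ker g) := by
  cases d with
  | zero => exact fun i hi => absurd hi (by lia)
  | succ d => exact hB.ker_succ hg (hC.mono (by lia))

end Depth

section DualSequence

variable {R : Type} [CommRing R] {B C : Type} [AddCommGroup B] [Module R B]
  [AddCommGroup C] [Module R C] {ω : Type} [AddCommGroup ω] [Module R ω]

lemma lcomp_subtype_ker_surjective {f : B →ₗ[R] C} (hf : Function.Surjective f)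
    (h : Subsingleton (Ext (ModuleCat.of R C) (ModuleCat.of R ω) 1)) :
    Function.Surjective (LinearMap.lcomp R ω (LinearMap.ker f).subtype) :=
  exists_extension_of_subsingleton_ext (LinearMap.ker f).injective_subtype hf
    (LinearMap.exact_subtype_ker_map f) h

lemma exact_lcomp_lcomp_subtype_ker (ω : Type) [AddCommGroup ω] [Module R ω]
    {f : B →ₗ[R] C} (hf : Function.Surjective f) :
    Function.Exact (LinearMap.lcomp R ω f) (LinearMap.lcomp R ω (LinearMap.ker f).subtype) :=
  LinearMap.exact_lcomp_of_exact_of_surjective ω (LinearMap.exact_subtype_ker_map f) hf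

lemma linearMap_fin_eq_sum_smulRight {n : ℕ} (h : (Fin n → R) →ₗ[R] ω) :
    h = ∑ i, (LinearMap.proj i : (Fin n → R) →ₗ[R] R).smulRight (h (Pi.single i 1)) := by
  refine LinearMap.pi_ext' fun i => LinearMap.ext_ring ?_
  simp [Pi.single_apply]

end DualSequence

namespace IsDualizing

variable {R : Type} [CommRing R] [IsLocalRing R] [IsNoetherianRing R] {d : ℕ}
  {ω : Type} [AddCommGroup ω] [Module R ω] [Module.Finite R ω] (hω : IsDualizing R d ω)
  {Z : Type} [AddCommGroup Z] [Module R Z] [Module.Finite R Z]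

include hω

lemma subsingleton_ext_succ (hZ : DepthAtLeast R d Z) (i : ℕ) :
    Subsingleton (Ext (ModuleCat.of R Z) (ModuleCat.of R ω) (i + 1)) :=
  subsingleton_ext_of_lt_add (fun N _ => hω.subsingleton_ext N) d (ModuleCat.of R Z) hZ (by lia)

omit [IsNoetherianRing R] [Module.Finite R ω] in
lemma depthAtLeast_dual_free (n : ℕ) : DepthAtLeast R d ((Fin n → R) →ₗ[R] ω) :=
  (hω.depth.pi n).congr ((Pi.basisFun R (Fin n)).constr R)

/-- The dual of a maximal Cohen-Macaulay module is maximal Cohen-Macaulay. -/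
lemma depthAtLeast_dual (hZ : DepthAtLeast R d Z) : DepthAtLeast R d (Z →ₗ[R] ω) := by
  suffices ∀ j ≤ d, DepthAtLeast R j (Z →ₗ[R] ω) from this d le_rfl
  intro j hj
  induction j generalizing Z with
  | zero => exact fun i hi => absurd hi (by lia)
  | succ j ih =>
    obtain ⟨n, f, hf⟩ := Module.Finite.exists_fin' R Z
    have hK := (hω.depth_ring.pi n).ker hf hZ
    have hker := lcomp_subtype_ker_surjective hf (hω.subsingleton_ext_succ hZ 0)
    refine (((hω.depthAtLeast_dual_free n).mono hj).ker_succ hker (ih hK (by lia))).congr ?_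
    exact (LinearEquiv.ofEq _ _ (LinearMap.exact_iff.1 (exact_lcomp_lcomp_subtype_ker ω hf))).trans
      (LinearEquiv.ofInjective _ (LinearMap.lcomp_injective_of_surjective f hf)).symm

omit [IsNoetherianRing R] [Module.Finite R ω] in
lemma not_subsingleton_ext_residueModule :
    ¬ Subsingleton (Ext (residueModule R) (ModuleCat.of R ω) d) := by
  obtain ⟨φ⟩ := hω.type_one
  rw [φ.toEquiv.subsingleton_congr, not_subsingleton_iff_nontrivial]
  infer_instance

/-- Every endomorphism of `ω` is a homothety. -/
lemma exists_eq_smul_id (f : ω →ₗ[R] ω) : ∃ r : R, f = r • LinearMap.id := by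
  obtain ⟨φ⟩ := hω.type_one
  obtain ⟨g', hg'⟩ := exists_span_singleton_ext_eq_top (fun N _ => hω.subsingleton_ext N) φ d 0
    (by lia) (ModuleCat.of R ω) hω.depth φ
  let e : Ext (ModuleCat.of R ω) (ModuleCat.of R ω) 0 ≃ₗ[R] (ω →ₗ[R] ω) :=
    Ext.linearEquiv₀.trans ModuleCat.homLinearEquiv
  have hg (f : ω →ₗ[R] ω) : ∃ r : R, f = r • e g' := by
    obtain ⟨r, hr⟩ := Submodule.mem_span_singleton.1
      (hg' ▸ Submodule.mem_top : e.symm f ∈ Submodule.span R {g'})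
    exact ⟨r, by rw [← map_smul, hr, LinearEquiv.apply_symm_apply]⟩
  obtain ⟨r, hr⟩ := hg LinearMap.id
  have hunit : IsUnit r := by
    by_contra hr'
    have : Subsingleton ω := subsingleton_of_forall_exists_smul (x := r)
      ((mem_maximalIdeal r).2 hr') fun v => ⟨e g' v, (LinearMap.congr_fun hr v).symm⟩
    refine hω.not_subsingleton_ext_residueModule (subsingleton_of_forall_eq 0 fun x => ?_)
    have h : 𝟙 (ModuleCat.of R ω) = 0 := by
      ext v
      exact Subsingleton.elim _ _
    rw [← Ext.comp_mk₀_id x, h, Ext.mk₀_zero, Ext.comp_zero]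
  obtain ⟨u, rfl⟩ := hunit
  obtain ⟨s, rfl⟩ := hg f
  refine ⟨s * ↑u⁻¹, ?_⟩
  rw [hr, smul_smul, mul_assoc, Units.inv_mul, mul_one]

/-- The canonical module is faithful. -/
lemma eq_zero_of_forall_smul_eq_zero (r : R) (hr : ∀ v : ω, r • v = 0) : r = 0 := by
  let g : R →ₗ[R] (ω →ₗ[R] ω) := LinearMap.toSpanSingleton R _ LinearMap.id
  have hg : Function.Surjective g := fun f => by
    obtain ⟨s, rfl⟩ := hω.exists_eq_smul_id f
    exact ⟨s, rfl⟩
  have hE : DepthAtLeast R d (ω →ₗ[R] ω) := hω.depthAtLeast_dual hω.depth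
  have hI := hω.depth_ring.ker hg hE
  have h0 : Subsingleton (LinearMap.ker g →ₗ[R] ω) := by
    refine subsingleton_of_forall_eq 0 fun f => ?_
    obtain ⟨f', rfl⟩ := exists_extension_of_subsingleton_ext (LinearMap.ker g).injective_subtype hg
      (LinearMap.exact_subtype_ker_map g) (hω.subsingleton_ext_succ hE 0) f
    ext x
    change f' (x : R) = 0
    rw [← mul_one (x : R), ← smul_eq_mul, map_smul]
    exact LinearMap.congr_fun (LinearMap.mem_ker.1 x.2) (f' 1)
  have : Subsingleton (LinearMap.ker g) := by
    refine subsingleton_of_forall_subsingleton_ext hω.ringKrullDim_eq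
      (fun N _ => hω.subsingleton_ext N) hω.not_subsingleton_ext_residueModule
      (ModuleCat.of R (LinearMap.ker g)) fun i => ?_
    cases i with
    | zero => exact subsingleton_ext_zero_iff.2 h0
    | succ i => exact hω.subsingleton_ext_succ hI i
  exact congrArg Subtype.val
    (Subsingleton.elim (⟨r, LinearMap.mem_ker.2 (LinearMap.ext hr)⟩ : LinearMap.ker g) 0)

lemma exists_eq_apply_of_dual_free {n : ℕ} (G : ((Fin n → R) →ₗ[R] ω) →ₗ[R] ω) :
    ∃ r : Fin n → R, ∀ h : (Fin n → R) →ₗ[R] ω, G h = h r := by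
  have H (i : Fin n) : ∃ r : R, ∀ v : ω,
      G ((LinearMap.proj i : (Fin n → R) →ₗ[R] R).smulRight v) = r • v := by
    obtain ⟨r, hr⟩ := hω.exists_eq_smul_id (G ∘ₗ LinearMap.smulRightₗ (LinearMap.proj i))
    exact ⟨r, fun v => LinearMap.congr_fun hr v⟩
  choose r hr using H
  refine ⟨r, fun h => ?_⟩
  rw [linearMap_fin_eq_sum_smulRight h]
  simp [LinearMap.sum_apply, hr]

lemma deltaMap_surjective (hZ : DepthAtLeast R d Z) : Function.Surjective (deltaMap R ω Z) := by
  intro g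
  obtain ⟨n, f, hf⟩ := Module.Finite.exists_fin' R Z
  have hK := (hω.depth_ring.pi n).ker hf hZ
  have hker := lcomp_subtype_ker_surjective hf (hω.subsingleton_ext_succ hZ 0)
  obtain ⟨G, rfl⟩ := exists_extension_of_subsingleton_ext
    (LinearMap.lcomp_injective_of_surjective (N := ω) f hf) hker
    (exact_lcomp_lcomp_subtype_ker ω hf)
    (hω.subsingleton_ext_succ (hω.depthAtLeast_dual hK) 0) g
  obtain ⟨r, hr⟩ := hω.exists_eq_apply_of_dual_free G
  exact ⟨f r, LinearMap.ext fun φ => (hr (φ ∘ₗ f)).symm⟩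

lemma deltaMap_injective (hZ : DepthAtLeast R d Z) : Function.Injective (deltaMap R ω Z) := by
  rw [injective_iff_map_eq_zero]
  intro z hz
  obtain ⟨n, f, hf⟩ := Module.Finite.exists_fin' R Z
  obtain ⟨y, rfl⟩ := hf z
  have hK := (hω.depth_ring.pi n).ker hf hZ
  have hker := lcomp_subtype_ker_surjective hf (hω.subsingleton_ext_succ hZ 0)
  have hle : LinearMap.ker (LinearMap.lcomp R ω (LinearMap.ker f).subtype) ≤
      LinearMap.ker (deltaMap R ω (Fin n → R) y) := by
    intro h hh
    obtain ⟨φ, rfl⟩ := (exact_lcomp_lcomp_subtype_ker ω hf h).1 hh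
    exact LinearMap.congr_fun hz φ
  let G : (LinearMap.ker f →ₗ[R] ω) →ₗ[R] ω :=
    Submodule.liftQ _ (deltaMap R ω (Fin n → R) y) hle ∘ₗ
      (LinearMap.quotKerEquivOfSurjective _ hker).symm.toLinearMap
  obtain ⟨w, hw⟩ := hω.deltaMap_surjective hK G
  have hyw (h : (Fin n → R) →ₗ[R] ω) : h y = h w := by
    have h1 : G (h ∘ₗ (LinearMap.ker f).subtype) = h y := by
      change Submodule.liftQ _ _ hle ((LinearMap.quotKerEquivOfSurjective _ hker).symm
        (LinearMap.lcomp R ω (LinearMap.ker f).subtype h)) = _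
      rw [(LinearEquiv.symm_apply_eq _).2
        (LinearMap.quotKerEquivOfSurjective_apply_mk _ hker h).symm]
      rfl
    rw [← h1, ← hw]
    rfl
  have : y = w := by
    ext i
    refine sub_eq_zero.1 (hω.eq_zero_of_forall_smul_eq_zero _ fun v => ?_)
    rw [sub_smul, sub_eq_zero]
    exact hyw ((LinearMap.proj i : (Fin n → R) →ₗ[R] R).smulRight v)
  rw [this]
  exact w.2

variable {M : Type} [AddCommGroup M] [Module R M] [Module.Finite R M]

lemma subsingleton_ext_of_dual (hM : Subsingleton (Ext (ModuleCat.of R M) (ModuleCat.of R ω) 1))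
    (hZ : DepthAtLeast R d Z)
    (h : Subsingleton (Ext (ModuleCat.of R (Z →ₗ[R] ω)) (ModuleCat.of R (M →ₗ[R] ω)) 1)) :
    Subsingleton (Ext (ModuleCat.of R M) (ModuleCat.of R Z) 1) := by
  obtain ⟨n, f, hf⟩ := Module.Finite.exists_fin' R M
  refine subsingleton_ext_one_of_exists_extension (LinearMap.ker f).injective_subtype hf
    (LinearMap.exact_subtype_ker_map f) fun u => ?_
  obtain ⟨s, hs⟩ := exists_lift_of_subsingleton_ext
    (LinearMap.lcomp_injective_of_surjective (N := ω) f hf) (lcomp_subtype_ker_surjective hf hM)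
    (exact_lcomp_lcomp_subtype_ker ω hf) h (LinearMap.lcomp R ω u)
  let δ := LinearEquiv.ofBijective (deltaMap R ω Z)
    ⟨hω.deltaMap_injective hZ, hω.deltaMap_surjective hZ⟩
  refine ⟨δ.symm.toLinearMap ∘ₗ s.flip, LinearMap.ext fun y => ?_⟩
  refine (LinearEquiv.symm_apply_eq δ).2 (LinearMap.ext fun ψ => ?_)
  exact LinearMap.congr_fun (LinearMap.congr_fun hs ψ) y

omit [Module.Finite R M] in
lemma subsingleton_ext_dual (hZ : DepthAtLeast R d Z)
    (h : Subsingleton (Ext (ModuleCat.of R M) (ModuleCat.of R (Z →ₗ[R] ω)) 1)) :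
    Subsingleton (Ext (ModuleCat.of R Z) (ModuleCat.of R (M →ₗ[R] ω)) 1) := by
  obtain ⟨n, f, hf⟩ := Module.Finite.exists_fin' R Z
  refine subsingleton_ext_one_of_exists_extension (LinearMap.ker f).injective_subtype hf
    (LinearMap.exact_subtype_ker_map f) fun u => ?_
  obtain ⟨s, hs⟩ := exists_lift_of_subsingleton_ext
    (LinearMap.lcomp_injective_of_surjective (N := ω) f hf)
    (lcomp_subtype_ker_surjective hf (hω.subsingleton_ext_succ hZ 0))
    (exact_lcomp_lcomp_subtype_ker ω hf) h u.flip
  refine ⟨s.flip, LinearMap.ext fun y => LinearMap.ext fun m => ?_⟩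
  exact LinearMap.congr_fun (LinearMap.congr_fun hs m) y

end IsDualizing

end Duality

section Comparison

variable {R : Type} [CommRing R]

lemma subsingleton_ext1_iff (n : ℕ) (M N : Type) [AddCommGroup M] [Module R M] [AddCommGroup N]
    [Module R N] :
    Subsingleton (ext1 R n M N) ↔ Subsingleton (Ext (ModuleCat.of R M) (ModuleCat.of R N) n) := by
  obtain ⟨e⟩ := nonempty_ext1_linearEquiv (R := R) n M N
  exact e.toEquiv.subsingleton_congr

variable [IsLocalRing R]

lemma le_rdepth_iff {d : ℕ} (Z : Type) [AddCommGroup Z] [Module R Z] :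
    (d : ℕ∞) ≤ rdepth R Z ↔ DepthAtLeast R d Z := by
  simp only [rdepth, le_sInf_iff, DepthAtLeast]
  constructor
  · intro h i hi
    by_contra h'
    have := h i ⟨i, rfl, fun h'' => h' ((subsingleton_ext1_iff i _ Z).1 h'')⟩
    exact absurd (Nat.cast_le.1 this) (by lia)
  · rintro h _ ⟨i, rfl, hi⟩
    by_contra! h'
    exact hi ((subsingleton_ext1_iff i _ Z).2 (h i (by exact_mod_cast h')))

lemma IsCanonicalModule.isDualizing [IsNoetherianRing R] {d : ℕ} (hdim : ringKrullDim R = d)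
    (hCM : (d : ℕ∞) ≤ rdepth R R) {ω : Type} [AddCommGroup ω] [Module R ω]
    (hω : IsCanonicalModule R d ω) : IsDualizing R d ω := by
  obtain ⟨⟨hfin, hdepth⟩, ⟨n, hn⟩, ⟨φ⟩⟩ := hω
  obtain ⟨e⟩ := nonempty_ext1_linearEquiv (R := R) d (ResidueField R) ω
  exact
    { ringKrullDim_eq := hdim
      depth_ring := (le_rdepth_iff R).1 hCM
      depth := (le_rdepth_iff ω).1 hdepth
      subsingleton_ext := fun N _ i hi => subsingleton_ext_of_ringKrullDim_lt hdim
        (ω := ModuleCat.of R ω) n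
        (fun N _ i hi => (subsingleton_ext1_iff i N ω).1 (hn N i (by lia))) N hi
      type_one := ⟨e.symm.trans φ⟩ }

end Comparison

end ExtDuality

/-- `Ext^1(M, Z) = 0` for every maximal Cohen-Macaulay `Z` iff
`Ext^1(M, ω) = 0` and `Ext^1(Z, M†) = 0` for every maximal Cohen-Macaulay `Z`. -/
theorem ext_vanishing_iff_dual (R : Type) [CommRing R] [IsNoetherianRing R] [IsLocalRing R]
    (d : ℕ) (hdim : ringKrullDim R = d) (hCM : (d : ℕ∞) ≤ rdepth R R)
    (ω : Type) [AddCommGroup ω] [Module R ω] (hω : IsCanonicalModule R d ω)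
    (M : Type) [AddCommGroup M] [Module R M] [Module.Finite R M] :
    (∀ (Z : Type) [AddCommGroup Z] [Module R Z], IsMCM R d Z →
        Subsingleton (ext1 R 1 M Z)) ↔
      Subsingleton (ext1 R 1 M ω) ∧
        ∀ (Z : Type) [AddCommGroup Z] [Module R Z], IsMCM R d Z →
          Subsingleton (ext1 R 1 Z (M →ₗ[R] ω)) := by
  have hD := hω.isDualizing hdim hCM
  have := hω.1.1
  simp only [subsingleton_ext1_iff]
  constructor
  · refine fun h => ⟨h ω hω.1, fun Z _ _ hZ => ?_⟩
    have := hZ.1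
    have hZ' := (le_rdepth_iff Z).1 hZ.2
    exact hD.subsingleton_ext_dual hZ'
      (h _ ⟨inferInstance, (le_rdepth_iff _).2 (hD.depthAtLeast_dual hZ')⟩)
  · rintro ⟨hM, h⟩ Z _ _ hZ
    have := hZ.1
    have hZ' := (le_rdepth_iff Z).1 hZ.2
    exact hD.subsingleton_ext_of_dual hM hZ'
      (h _ ⟨inferInstance, (le_rdepth_iff _).2 (hD.depthAtLeast_dual hZ')⟩)
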